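/- In Version B, if G is a position having at least one pile of size at least 2, then the position obtained from G by adjoining two additional piles of size 2 has the same outcome class as G: it is a P-position if and only if G is a P-position. -/

import Mathlib

/-- Remove one token from a pile of size `p` in `G`: delete one copy of `p` and,
if `p ≠ 1`, add back a pile of size `p - 1`. -/
def takeOne (G : Multiset ℕ) (p : ℕ) : Multiset ℕ :=
  G.erase p + (if p = 1 then (0 : Multiset ℕ) else {p - 1})

/-- Legal moves of Version B: remove one token from one chosen pile, or remove
one token from every pile simultaneously (piles reaching size 0 are deleted). -/
inductive MoveB : Multiset ℕ → Multiset ℕ → Prop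
  | one {G : Multiset ℕ} {p : ℕ} (hp : p ∈ G) (h1 : 1 ≤ p) : MoveB G (takeOne G p)
  | all {G : Multiset ℕ} (hG : G ≠ 0) : MoveB G ((G.map (· - 1)).filter (· ≠ 0))

mutual
  /-- P-positions of Version B under normal play: every move leads to an N-position
  (in particular the empty position is a P-position).  Since every move strictly
  decreases the total number of tokens, this inductive definition agrees with the
  usual recursive definition of outcome classes. -/
  inductive PPosB : Multiset ℕ → Prop
    | mk : ∀ {G : Multiset ℕ}, (∀ H, MoveB G H → NPosB H) → PPosB G
  /-- N-positions of Version B under normal play: some move leads to a P-position. -/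
  inductive NPosB : Multiset ℕ → Prop
    | mk : ∀ {G H : Multiset ℕ}, MoveB G H → PPosB H → NPosB G
end

/-- The result of removing one token from every pile simultaneously. -/
def takeAll (G : Multiset ℕ) : Multiset ℕ :=
  (G.map (· - 1)).filter (· ≠ 0)

theorem takeOne_cons_of_mem {G : Multiset ℕ} {p : ℕ} (a : ℕ) (hp : p ∈ G) :
    takeOne (a ::ₘ G) p = a ::ₘ takeOne G p := by
  simp only [takeOne, Multiset.erase_cons_tail_of_mem hp, Multiset.cons_add]

theorem takeOne_one_cons (G : Multiset ℕ) : takeOne (1 ::ₘ G) 1 = G := by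
  simp [takeOne]

theorem takeOne_two_cons (G : Multiset ℕ) : takeOne (2 ::ₘ G) 2 = 1 ::ₘ G := by
  simp [takeOne, add_comm G, Multiset.singleton_add]

theorem sum_takeOne {G : Multiset ℕ} {p : ℕ} (hp : p ∈ G) (h1 : 1 ≤ p) :
    (takeOne G p).sum + 1 = G.sum := by
  have h := Multiset.sum_erase hp
  rw [takeOne, Multiset.sum_add]
  split_ifs with hp1
  · subst hp1
    simp only [Multiset.sum_zero]
    omega
  · simp only [Multiset.sum_singleton]
    omega

theorem card_takeOne_le {G : Multiset ℕ} {p : ℕ} (hp : p ∈ G) :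
    (takeOne G p).card ≤ G.card := by
  have h := Multiset.card_erase_add_one hp
  rw [takeOne, Multiset.card_add]
  split_ifs <;> simp <;> omega

theorem takeAll_cons_one (G : Multiset ℕ) : takeAll (1 ::ₘ G) = takeAll G := by
  simp [takeAll]

theorem takeAll_cons_two (G : Multiset ℕ) : takeAll (2 ::ₘ G) = 1 ::ₘ takeAll G := by
  simp [takeAll]

theorem mem_takeAll {G : Multiset ℕ} {q : ℕ} (hq : q ∈ G) (h2 : 2 ≤ q) :
    q - 1 ∈ takeAll G := by
  simp only [takeAll, Multiset.mem_filter, Multiset.mem_map]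
  exact ⟨⟨q, hq, rfl⟩, by omega⟩

theorem sum_add_card_takeAll_lt {G : Multiset ℕ} (hG : G ≠ 0) :
    (takeAll G).sum + (takeAll G).card < G.sum + G.card := by
  have key : ∀ G : Multiset ℕ, (takeAll G).sum + (takeAll G).card ≤ G.sum := by
    intro G
    induction G using Multiset.induction_on with
    | empty => simp [takeAll]
    | cons a G ih =>
      simp only [takeAll, Multiset.map_cons, Multiset.filter_cons, Multiset.sum_add,
        Multiset.card_add, Multiset.sum_cons] at ih ⊢
      split_ifs <;> simp only [Multiset.sum_zero, Multiset.card_zero, Multiset.sum_singleton,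
        Multiset.card_singleton] <;> omega
  have := key G
  have := Multiset.card_pos.mpr hG
  omega

theorem MoveB.sum_add_card_lt {G H : Multiset ℕ} (h : MoveB G H) :
    H.sum + H.card < G.sum + G.card := by
  cases h with
  | one hp h1 =>
    have := sum_takeOne hp h1
    have := card_takeOne_le hp
    omega
  | all hG => exact sum_add_card_takeAll_lt hG

theorem nPosB_iff_exists {G : Multiset ℕ} : NPosB G ↔ ∃ H, MoveB G H ∧ PPosB H :=
  ⟨fun ⟨hm, hp⟩ => ⟨_, hm, hp⟩, fun ⟨_, hm, hp⟩ => ⟨hm, hp⟩⟩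

theorem pPosB_iff_forall_nPosB {G : Multiset ℕ} : PPosB G ↔ ∀ H, MoveB G H → NPosB H :=
  ⟨fun ⟨h⟩ => h, fun h => ⟨h⟩⟩

theorem nPosB_iff_not_pPosB (G : Multiset ℕ) : NPosB G ↔ ¬ PPosB G := by
  induction hn : G.sum + G.card using Nat.strong_induction_on generalizing G with
  | _ n ih =>
    rw [nPosB_iff_exists, pPosB_iff_forall_nPosB]
    push Not
    refine exists_congr fun H => and_congr_right fun hm => ?_
    rw [ih _ (hn ▸ hm.sum_add_card_lt) H rfl, not_not]

theorem pPosB_iff {G : Multiset ℕ} :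
    PPosB G ↔ (∀ p ∈ G, 1 ≤ p → ¬ PPosB (takeOne G p)) ∧ (G ≠ 0 → ¬ PPosB (takeAll G)) := by
  simp only [pPosB_iff_forall_nPosB (G := G), nPosB_iff_not_pPosB]
  refine ⟨fun h => ⟨fun p hp h1 => h _ (.one hp h1), fun hG => h _ (.all hG)⟩, ?_⟩
  rintro ⟨h1, h2⟩ H (⟨hp, hp1⟩ | hG)
  · exact h1 _ hp hp1
  · exact h2 hG

theorem not_pPosB_of_takeOne {G : Multiset ℕ} {p : ℕ} (hp : p ∈ G) (h1 : 1 ≤ p)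
    (h : PPosB (takeOne G p)) : ¬ PPosB G :=
  fun hG => (pPosB_iff.mp hG).1 p hp h1 h

theorem PPosB.not_one_cons {G : Multiset ℕ} (h : PPosB G) : ¬ PPosB (1 ::ₘ G) :=
  not_pPosB_of_takeOne (p := 1) (by simp) le_rfl (by rwa [takeOne_one_cons])

theorem not_pPosB_of_le_one {G : Multiset ℕ} (hG : G ≠ 0) (h : ∀ p ∈ G, p ≤ 1) :
    ¬ PPosB G := by
  intro hP
  refine (pPosB_iff.mp hP).2 hG ?_
  have : takeAll G = 0 := by
    simp only [takeAll, Multiset.filter_eq_nil, Multiset.mem_map]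
    rintro _ ⟨p, hp, rfl⟩
    have := h p hp
    omega
  rw [this, pPosB_iff]
  simp

theorem takeOne_ne_zero {G : Multiset ℕ} {p q : ℕ} (hq : q ∈ G) (h2 : 2 ≤ q) :
    takeOne G p ≠ 0 := by
  by_cases hqp : q = p
  · subst hqp
    simp [takeOne, show q ≠ 1 by omega]
  · intro h
    have : q ∈ takeOne G p :=
      Multiset.mem_add.mpr (.inl ((Multiset.mem_erase_of_ne hqp).mpr hq))
    simp [h] at this

/-- Adjoining two piles of size 1 to a position having a pile of size at least 2 does not
change its outcome class. -/
theorem pPosB_one_one_cons (G : Multiset ℕ) (h2 : ∃ q ∈ G, 2 ≤ q) :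
    PPosB (1 ::ₘ 1 ::ₘ G) ↔ PPosB G := by
  induction hn : G.sum using Nat.strong_induction_on generalizing G with
  | _ n ih =>
    obtain ⟨q, hq, hq2⟩ := h2
    have step : ∀ p ∈ G, 1 ≤ p →
        (PPosB (1 ::ₘ 1 ::ₘ takeOne G p) ↔ PPosB (takeOne G p)) := by
      intro p hp h1
      have hlt := sum_takeOne hp h1
      by_cases hbig : ∃ r ∈ takeOne G p, 2 ≤ r
      · exact ih _ (by omega) _ hbig rfl
      · have hle : ∀ r ∈ takeOne G p, r ≤ 1 := by
          intro r hr
          by_contra hlt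
          exact hbig ⟨r, hr, by omega⟩
        refine iff_of_false (not_pPosB_of_le_one (by simp) ?_)
          (not_pPosB_of_le_one (takeOne_ne_zero hq hq2) hle)
        simpa using hle
    have hG : G ≠ 0 := by
      rintro rfl
      simp at hq
    constructor
    · intro h
      rw [pPosB_iff] at h ⊢
      refine ⟨fun p hp h1 => ?_, fun _ => ?_⟩
      · rw [← step p hp h1, ← takeOne_cons_of_mem 1 hp,
          ← takeOne_cons_of_mem 1 (Multiset.mem_cons_of_mem hp)]
        exact h.1 p (by simp [hp]) h1
      · simpa only [takeAll_cons_one] using h.2 (by simp)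
    · intro h
      have h' := pPosB_iff.mp h
      refine pPosB_iff.mpr ⟨fun p hp h1 => ?_, fun _ => ?_⟩
      · by_cases hpG : p ∈ G
        · rw [takeOne_cons_of_mem 1 (Multiset.mem_cons_of_mem hpG),
            takeOne_cons_of_mem 1 hpG, step p hpG h1]
          exact h'.1 p hpG h1
        · obtain rfl : p = 1 := by simpa [hpG] using hp
          rw [takeOne_one_cons]
          exact h.not_one_cons
      · simpa only [takeAll_cons_one] using h'.2 hG

theorem pPosB_two : PPosB {2} := by
  refine pPosB_iff.mpr ⟨fun p hp _ => ?_, fun _ => ?_⟩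
  · obtain rfl : p = 2 := by simpa using hp
    exact not_pPosB_of_le_one (by decide) (by decide)
  · exact not_pPosB_of_le_one (by decide) (by decide)

theorem pPosB_two_two : PPosB {2, 2} := by
  refine pPosB_iff.mpr ⟨fun p hp _ => ?_, fun _ => ?_⟩
  · obtain rfl : p = 2 := by simpa using hp
    exact (takeOne_two_cons {2}) ▸ pPosB_two.not_one_cons
  · exact not_pPosB_of_le_one (by decide) (by decide)

theorem pPosB_two_two_two : PPosB {2, 2, 2} := by
  refine pPosB_iff.mpr ⟨fun p hp _ => ?_, fun _ => ?_⟩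
  · obtain rfl : p = 2 := by simpa using hp
    exact (takeOne_two_cons {2, 2}) ▸ pPosB_two_two.not_one_cons
  · exact not_pPosB_of_le_one (by decide) (by decide)

theorem pPosB_two_cons_ones (n : ℕ) :
    PPosB (2 ::ₘ 2 ::ₘ 2 ::ₘ Multiset.replicate n 1) ↔
      PPosB (2 ::ₘ Multiset.replicate n 1) := by
  induction n using Nat.twoStepInduction with
  | zero => exact iff_of_true pPosB_two_two_two pPosB_two
  | one =>
    simp only [Multiset.replicate_one, ← Multiset.cons_zero, Multiset.cons_swap 2 1]
    exact iff_of_false pPosB_two_two_two.not_one_cons pPosB_two.not_one_cons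
  | more n ih _ =>
    simp only [Multiset.replicate_succ, Multiset.cons_swap 2 1]
    rw [pPosB_one_one_cons _ ⟨2, by simp, le_rfl⟩, pPosB_one_one_cons _ ⟨2, by simp, le_rfl⟩, ih]

theorem zero_notMem_takeOne {G : Multiset ℕ} {p : ℕ} (hG : 0 ∉ G) (h1 : 1 ≤ p) :
    0 ∉ takeOne G p := by
  rw [takeOne, Multiset.mem_add, not_or]
  refine ⟨fun h => hG (Multiset.mem_of_mem_erase h), ?_⟩
  split_ifs <;> simp
  omega

theorem exists_two_le_mem_takeOne {G : Multiset ℕ} {p : ℕ} (hG : 0 ∉ G)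
    (h2 : ∃ q ∈ G, 2 ≤ q) (hform : ¬ ∃ n, G = 2 ::ₘ Multiset.replicate n 1) :
    ∃ r ∈ takeOne G p, 2 ≤ r := by
  obtain ⟨q, hq, hq2⟩ := h2
  by_contra! hsmall
  have herase : ∀ r ∈ G.erase p, r < 2 := fun r hr =>
    hsmall r (Multiset.mem_add.mpr (.inl hr))
  obtain rfl : q = p := by
    by_contra hqp
    exact absurd (herase q ((Multiset.mem_erase_of_ne hqp).mpr hq)) (by omega)
  have hq1 : q - 1 < 2 := hsmall _ (by simp [takeOne, show q ≠ 1 by omega])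
  obtain rfl : q = 2 := by omega
  refine hform ⟨(G.erase 2).card, ?_⟩
  rw [← Multiset.eq_replicate_card.mpr fun r hr => ?_, Multiset.cons_erase hq]
  have := herase r hr
  have : r ≠ 0 := fun h => hG (h ▸ Multiset.mem_of_mem_erase hr)
  omega

/-- In Version B, adjoining two piles of size 2 to a position having a pile of size
at least 2 does not change its outcome class. -/
theorem versionB_add_two_twos (G : Multiset ℕ) (hG : 0 ∉ G)
    (h2 : ∃ p ∈ G, 2 ≤ p) :
    PPosB (2 ::ₘ 2 ::ₘ G) ↔ PPosB G := by
  induction hn : G.sum using Nat.strong_induction_on generalizing G with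
  | _ n ih =>
    by_cases hform : ∃ n, G = 2 ::ₘ Multiset.replicate n 1
    · obtain ⟨n, rfl⟩ := hform
      exact pPosB_two_cons_ones n
    have step : ∀ p ∈ G, 1 ≤ p →
        (PPosB (2 ::ₘ 2 ::ₘ takeOne G p) ↔ PPosB (takeOne G p)) := by
      intro p hp h1
      have hlt := sum_takeOne hp h1
      exact ih _ (by omega) _ (zero_notMem_takeOne hG h1)
        (exists_two_le_mem_takeOne hG h2 hform) rfl
    have stepAll : PPosB (1 ::ₘ 1 ::ₘ takeAll G) ↔ PPosB (takeAll G) := by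
      by_cases hbig : ∃ r ∈ takeAll G, 2 ≤ r
      · exact pPosB_one_one_cons _ hbig
      · push Not at hbig
        have hle : ∀ r ∈ takeAll G, r ≤ 1 := fun r hr => Nat.le_of_lt_succ (hbig r hr)
        obtain ⟨q, hq, hq2⟩ := h2
        refine iff_of_false (not_pPosB_of_le_one (by simp) (by simpa using hle))
          (not_pPosB_of_le_one (fun h => ?_) hle)
        simpa [h] using mem_takeAll hq hq2
    have hG0 : G ≠ 0 := by
      rintro rfl
      simp at h2
    constructor
    · intro h
      rw [pPosB_iff] at h ⊢
      refine ⟨fun p hp h1 => ?_, fun _ => ?_⟩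
      · rw [← step p hp h1, ← takeOne_cons_of_mem 2 hp,
          ← takeOne_cons_of_mem 2 (Multiset.mem_cons_of_mem hp)]
        exact h.1 p (by simp [hp]) h1
      · simpa only [takeAll_cons_two, stepAll] using h.2 (by simp)
    · intro h
      have h' := pPosB_iff.mp h
      refine pPosB_iff.mpr ⟨fun p hp h1 => ?_, fun _ => ?_⟩
      · by_cases hpG : p ∈ G
        · rw [takeOne_cons_of_mem 2 (Multiset.mem_cons_of_mem hpG),
            takeOne_cons_of_mem 2 hpG, step p hpG h1]
          exact h'.1 p hpG h1
        · obtain rfl : p = 2 := by simpa [hpG] using hp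
          rw [takeOne_two_cons, Multiset.cons_swap]
          refine not_pPosB_of_takeOne (p := 2) (by simp) (by omega) ?_
          rwa [takeOne_two_cons, pPosB_one_one_cons G h2]
      · rw [takeAll_cons_two, takeAll_cons_two, stepAll]
        exact h'.2 hG0
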